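/- Termination property of Protocol PIF: starting from any configuration, under Hypothesis 1, any PIF-computation (even one not explicitly started) terminates in finite time; i.e., for every process p, it is impossible that Request_p ≠ Done holds forever in an execution: p eventually executes Request_p := Done. -/

import Mathlib

/-!
A formal model of Protocol PIF (Algorithm 1) in a fully-connected
message-passing system with unreliable, fair, single-message-capacity
channels.  Processes are `Fin n`; broadcast/feedback data range over `D`.

Every configuration is a possible initial configuration; an execution is an
infinite sequence of atomic steps, each step being an external request
(`env`), an external setting of a feedback message (`setF`), one of the
actions `A1`, `A2`, `A3` of Protocol PIF, or the loss of a message in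
transit.  Fairness of channels and weak fairness of enabled protocol actions
are part of the notion of execution.
-/

set_option autoImplicit false

namespace PIF

inductive Req where
  | Wait | In | Done
deriving DecidableEq

/-- A `⟨PIF, B, F, qState, pState⟩` message: the broadcast data, the feedback
data, the sender's `State[receiver]`, and the sender's `NeigState[receiver]`. -/
structure Msg (D : Type*) where
  b : D
  f : D
  sSt : Fin 5
  sNg : Fin 5

/-- A configuration: the variables of each process together with the contents
of every channel (single-message capacity, hence `Option`).
`chan p q` is the channel from `p` to `q`. -/
structure Cfg (n : ℕ) (D : Type*) where
  req : Fin n → Req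
  bmes : Fin n → D
  fmes : Fin n → Fin n → D
  st : Fin n → Fin n → Fin 5
  ng : Fin n → Fin n → Fin 5
  chan : Fin n → Fin n → Option (Msg D)

inductive Act (n : ℕ) (D : Type*) where
  /-- external request to broadcast `b`: `Request p := Wait`, `B-Mes p := b` -/
  | env (p : Fin n) (b : D)
  /-- the application externally sets the feedback message `F-Mes p [q] := f` -/
  | setF (p q : Fin n) (f : D)
  /-- action `A1` of process `p` (the starting action) -/
  | a1 (p : Fin n)
  /-- action `A2` of process `p` (decision or (re)sending) -/
  | a2 (p : Fin n)
  /-- action `A3`: process `p` receives message `m` from process `q` -/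
  | a3 (p q : Fin n) (m : Msg D)
  /-- the message in transit from `p` to `q` is lost -/
  | lose (p q : Fin n)

variable {n : ℕ} {D : Type*}

def upd2 {β : Type*} (f : Fin n → Fin n → β) (p q : Fin n) (v : β) :
    Fin n → Fin n → β :=
  fun a b => if a = p ∧ b = q then v else f a b

/-- Sending into a single-capacity unreliable channel: if the channel is full
the message is lost; if it is empty, the message is put in the channel or
lost. -/
def send (old : Option (Msg D)) (m : Msg D) (new : Option (Msg D)) : Prop :=
  (old ≠ none ∧ new = old) ∨ (old = none ∧ (new = some m ∨ new = none))

/-- The semantics of one atomic step `γ —A→ γ'`. -/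
def StepAt (γ : Cfg n D) : Act n D → Cfg n D → Prop
  | .env p b, γ' =>
      γ' = { γ with req := Function.update γ.req p .Wait,
                    bmes := Function.update γ.bmes p b }
  | .setF p q f, γ' =>
      γ' = { γ with fmes := upd2 γ.fmes p q f }
  | .a1 p, γ' =>
      γ.req p = .Wait ∧
      γ' = { γ with req := Function.update γ.req p .In,
                    st := Function.update γ.st p (fun _ => 0) }
  | .a2 p, γ' =>
      γ.req p = .In ∧
      (((∀ q, q ≠ p → γ.st p q = 4) ∧
          γ' = { γ with req := Function.update γ.req p .Done }) ∨
       ((¬ ∀ q, q ≠ p → γ.st p q = 4) ∧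
          γ'.req = γ.req ∧ γ'.bmes = γ.bmes ∧ γ'.fmes = γ.fmes ∧
          γ'.st = γ.st ∧ γ'.ng = γ.ng ∧
          (∀ q, q ≠ p → γ.st p q ≠ 4 →
            send (γ.chan p q) ⟨γ.bmes p, γ.fmes p q, γ.st p q, γ.ng p q⟩
              (γ'.chan p q)) ∧
          (∀ a b, ¬ (a = p ∧ b ≠ p ∧ γ.st p b ≠ 4) → γ'.chan a b = γ.chan a b)))
  | .a3 p q m, γ' =>
      q ≠ p ∧ γ.chan q p = some m ∧
      (let st' : Fin 5 :=
        if γ.st p q = m.sNg ∧ (γ.st p q : ℕ) < 4 then γ.st p q + 1 else γ.st p q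
       γ'.req = γ.req ∧ γ'.bmes = γ.bmes ∧ γ'.fmes = γ.fmes ∧
       γ'.st = upd2 γ.st p q st' ∧
       γ'.ng = upd2 γ.ng p q m.sSt ∧
       γ'.chan q p = none ∧
       (((m.sSt : ℕ) < 4 ∧
           send (γ.chan p q) ⟨γ.bmes p, γ.fmes p q, st', m.sSt⟩ (γ'.chan p q)) ∨
        (¬ (m.sSt : ℕ) < 4 ∧ γ'.chan p q = γ.chan p q)) ∧
       (∀ a b, ¬ (a = q ∧ b = p) → ¬ (a = p ∧ b = q) →
          γ'.chan a b = γ.chan a b))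
  | .lose p q, γ' =>
      (∃ m, γ.chan p q = some m) ∧
      γ'.req = γ.req ∧ γ'.bmes = γ.bmes ∧ γ'.fmes = γ.fmes ∧
      γ'.st = γ.st ∧ γ'.ng = γ.ng ∧
      γ'.chan p q = none ∧
      (∀ a b, ¬ (a = p ∧ b = q) → γ'.chan a b = γ.chan a b)

/-- A `receive-brd⟨B⟩ from q` event is generated at `p` in step `γ —A→ ·`. -/
def brdEvent (γ : Cfg n D) (A : Act n D) (p q : Fin n) (B : D) : Prop :=
  ∃ m : Msg D, A = .a3 p q m ∧ m.b = B ∧ γ.ng p q ≠ 3 ∧ m.sSt = 3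

/-- A `receive-fck⟨F⟩ from q` event is generated at `p` in step `γ —A→ ·`
(i.e. `State p [q]` switches from 3 to 4). -/
def fckEvent (γ : Cfg n D) (A : Act n D) (p q : Fin n) (F : D) : Prop :=
  ∃ m : Msg D, A = .a3 p q m ∧ m.f = F ∧ γ.st p q = 3 ∧ m.sNg = 3

def Enabled (γ : Cfg n D) (A : Act n D) : Prop := ∃ γ', StepAt γ A γ'

/-- The actions of the protocol proper (weak fairness applies to these). -/
def ProcAct : Act n D → Prop
  | .a1 _ => True
  | .a2 _ => True
  | .a3 _ _ _ => True
  | _ => False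

/-- Step `i` attempts to send a message from `p` to `q`. -/
def SendAttempt (γ : ℕ → Cfg n D) (act : ℕ → Act n D) (i : ℕ)
    (p q : Fin n) : Prop :=
  (act i = .a2 p ∧ (γ i).req p = .In ∧ q ≠ p ∧ (γ i).st p q ≠ 4 ∧
     ¬ ∀ r, r ≠ p → (γ i).st p r = 4) ∨
  (∃ m : Msg D, act i = .a3 p q m ∧ (m.sSt : ℕ) < 4)

/-- An execution: an infinite sequence of valid atomic steps starting from an
arbitrary configuration, in which (weak fairness) every protocol action that
is continuously enabled is eventually executed, and (channel fairness) if
infinitely many messages are sent from `p` to `q` then `q` receives a message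
from `p` infinitely often. -/
structure Exec (n : ℕ) (D : Type*) where
  γ : ℕ → Cfg n D
  act : ℕ → Act n D
  valid : ∀ i, StepAt (γ i) (act i) (γ (i + 1))
  wf : ∀ A : Act n D, ProcAct A →
        (∃ i, ∀ j, i ≤ j → Enabled (γ j) A) → ∀ i, ∃ j, i ≤ j ∧ act j = A
  chanFair : ∀ p q : Fin n, p ≠ q →
        (∀ i, ∃ j, i ≤ j ∧ SendAttempt γ act j p q) →
        ∀ i, ∃ j, i ≤ j ∧ ∃ m : Msg D, act j = .a3 q p m

/-- Hypothesis 1: while `Request p ≠ Done`, `Request p` is not externally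
set to `Wait`. -/
def Hyp1 (e : Exec n D) : Prop :=
  ∀ i p b, e.act i = .env p b → (e.γ i).req p = .Done

end PIF

namespace PIF

theorem fin5_le : ∀ x : Fin 5, (x : ℕ) < 4 → x ≤ x + 1 := by decide

theorem fin5_lt : ∀ x : Fin 5, x ≠ 4 → (x : ℕ) < 4 := by decide

theorem fin5_ne : ∀ x : Fin 5, (x : ℕ) < 4 → x + 1 ≠ x := by decide

theorem step_req {n : ℕ} {D : Type*} {γ γ' : Cfg n D} {A : Act n D} (h : StepAt γ A γ')
    (p : Fin n) (hp : γ.req p = .In) (hd : γ'.req p ≠ .Done) (he : ∀ b, A ≠ .env p b) :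
    γ'.req p = .In := by
  cases A with
  | env a b =>
    have : p ≠ a := by rintro rfl; exact he b rfl
    simp only [StepAt] at h; subst h; simp [Function.update_of_ne this, hp]
  | setF a b f => simp only [StepAt] at h; subst h; exact hp
  | a1 a =>
    simp only [StepAt] at h; obtain ⟨h0, rfl⟩ := h
    by_cases hpa : p = a
    · subst hpa; simp
    · simp [Function.update_of_ne hpa, hp]
  | a2 a =>
    simp only [StepAt] at h
    obtain ⟨h0, ⟨_, rfl⟩ | ⟨_, h2, _⟩⟩ := h
    · by_cases hpa : p = a
      · subst hpa; simp at hd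
      · simp [Function.update_of_ne hpa, hp]
    · rw [h2, hp]
  | a3 a b m => simp only [StepAt] at h; rw [h.2.2.1, hp]
  | lose a b => simp only [StepAt] at h; rw [h.2.1, hp]

theorem step_wait {n : ℕ} {D : Type*} {γ γ' : Cfg n D} {A : Act n D} (h : StepAt γ A γ')
    (p : Fin n) (hp : γ.req p = .Wait) (hA : A ≠ .a1 p) : γ'.req p = .Wait := by
  cases A with
  | env a b =>
    simp only [StepAt] at h; subst h
    by_cases hpa : p = a
    · subst hpa; simp
    · simp [Function.update_of_ne hpa, hp]
  | setF a b f => simp only [StepAt] at h; subst h; exact hp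
  | a1 a =>
    simp only [StepAt] at h; obtain ⟨h0, rfl⟩ := h
    have hpa : p ≠ a := by rintro rfl; exact hA rfl
    simp [Function.update_of_ne hpa, hp]
  | a2 a =>
    simp only [StepAt] at h
    obtain ⟨h0, ⟨_, rfl⟩ | ⟨_, h2, _⟩⟩ := h
    · have hpa : p ≠ a := by rintro rfl; rw [hp] at h0; cases h0
      simp [Function.update_of_ne hpa, hp]
    · rw [h2, hp]
  | a3 a b m => simp only [StepAt] at h; rw [h.2.2.1, hp]
  | lose a b => simp only [StepAt] at h; rw [h.2.1, hp]

theorem step_st {n : ℕ} {D : Type*} {γ γ' : Cfg n D} {A : Act n D} (h : StepAt γ A γ')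
    (p q : Fin n) (hp : γ.req p = .In) : γ.st p q ≤ γ'.st p q := by
  cases A with
  | env a b => simp only [StepAt] at h; subst h; exact le_rfl
  | setF a b f => simp only [StepAt] at h; subst h; exact le_rfl
  | a1 a =>
    simp only [StepAt] at h; obtain ⟨h0, rfl⟩ := h
    have hpa : p ≠ a := by rintro rfl; rw [hp] at h0; cases h0
    simp [Function.update_of_ne hpa]
  | a2 a =>
    simp only [StepAt] at h
    obtain ⟨h0, ⟨_, rfl⟩ | ⟨_, _, _, _, h2, _⟩⟩ := h
    · exact le_rfl
    · rw [h2]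
  | a3 a b m =>
    simp only [StepAt] at h
    rw [h.2.2.2.2.2.1]
    simp only [upd2]
    split_ifs with h1 h2
    · obtain ⟨rfl, rfl⟩ := h1
      have := h2.2
      exact fin5_le _ this
    · obtain ⟨rfl, rfl⟩ := h1; exact le_rfl
    · exact le_rfl
  | lose a b => simp only [StepAt] at h; rw [h.2.2.2.2.1]

theorem step_chan {n : ℕ} {D : Type*} {γ γ' : Cfg n D} {A : Act n D} (h : StepAt γ A γ')
    (p q : Fin n) (m : Msg D) (hm : γ'.chan p q = some m) :
    γ.chan p q = some m ∨ (m.sSt = γ'.st p q ∧ m.sNg = γ'.ng p q) := by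
  cases A with
  | env a b => simp only [StepAt] at h; subst h; exact Or.inl hm
  | setF a b f => simp only [StepAt] at h; subst h; exact Or.inl hm
  | a1 a => simp only [StepAt] at h; obtain ⟨h0, rfl⟩ := h; exact Or.inl hm
  | a2 a =>
    simp only [StepAt] at h
    obtain ⟨h0, ⟨_, rfl⟩ | ⟨_, _, _, _, h2, h3, h4, h5⟩⟩ := h
    · exact Or.inl hm
    · by_cases hc : p = a ∧ q ≠ a ∧ γ.st a q ≠ 4
      · obtain ⟨rfl, hc1, hc2⟩ := hc
        rcases h4 q hc1 hc2 with ⟨_, h6⟩ | ⟨_, h6 | h6⟩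
        · left; rw [← h6, hm]
        · right; rw [hm] at h6; cases h6; simp [h2, h3]
        · rw [hm] at h6; cases h6
      · left; rw [← h5 p q hc, hm]
  | a3 a b m' =>
    simp only [StepAt] at h
    obtain ⟨hab, hch, _, _, _, hst, hng, hnone, hs, ho⟩ := h
    by_cases hc : p = b ∧ q = a
    · obtain ⟨rfl, rfl⟩ := hc; rw [hm] at hnone; cases hnone
    · by_cases hc' : p = a ∧ q = b
      · obtain ⟨rfl, rfl⟩ := hc'
        rcases hs with ⟨_, ⟨_, h6⟩ | ⟨_, h6 | h6⟩⟩ | ⟨_, h6⟩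
        · left; rw [← h6, hm]
        · right; rw [hm] at h6; cases h6; simp [hst, hng, upd2]
        · rw [hm] at h6; cases h6
        · left; rw [← h6, hm]
      · left; rw [← ho p q hc hc', hm]
  | lose a b =>
    simp only [StepAt] at h
    obtain ⟨_, _, _, _, _, _, h1, h2⟩ := h
    by_cases hc : p = a ∧ q = b
    · obtain ⟨rfl, rfl⟩ := hc; rw [hm] at h1; cases h1
    · left; rw [← h2 p q hc, hm]

theorem step_ng {n : ℕ} {D : Type*} {γ γ' : Cfg n D} {A : Act n D} (h : StepAt γ A γ')
    (p q : Fin n) :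
    γ'.ng p q = γ.ng p q ∨ ∃ m, γ.chan q p = some m ∧ γ'.ng p q = m.sSt := by
  cases A with
  | env a b => simp only [StepAt] at h; subst h; exact Or.inl rfl
  | setF a b f => simp only [StepAt] at h; subst h; exact Or.inl rfl
  | a1 a => simp only [StepAt] at h; obtain ⟨h0, rfl⟩ := h; exact Or.inl rfl
  | a2 a =>
    simp only [StepAt] at h
    obtain ⟨h0, ⟨_, rfl⟩ | ⟨_, _, _, _, h2, h3, h4, h5⟩⟩ := h
    · exact Or.inl rfl
    · left; rw [h3]
  | a3 a b m' =>
    simp only [StepAt] at h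
    obtain ⟨hab, hch, _, _, _, hst, hng, hnone, hs, ho⟩ := h
    by_cases hc' : p = a ∧ q = b
    · obtain ⟨rfl, rfl⟩ := hc'
      exact Or.inr ⟨m', hch, by simp [hng, upd2]⟩
    · left; simp [hng, upd2, hc']
  | lose a b => simp only [StepAt] at h; left; rw [h.2.2.2.2.2.1]

theorem step_recv {n : ℕ} {D : Type*} {γ γ' : Cfg n D} {p q : Fin n} {m : Msg D}
    (h : StepAt γ (.a3 p q m) γ') :
    γ.chan q p = some m ∧ γ'.chan q p = none ∧ γ'.ng p q = m.sSt ∧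
    (γ.st p q = m.sNg → γ.st p q ≠ 4 → γ'.st p q ≠ γ.st p q) := by
  simp only [StepAt] at h
  obtain ⟨hab, hch, _, _, _, hst, hng, hnone, hs, ho⟩ := h
  refine ⟨hch, hnone, by simp [hng, upd2], fun h1 h2 => ?_⟩
  rw [hst]
  have h3 : (γ.st p q : ℕ) < 4 := fin5_lt _ h2
  simp only [upd2, and_self, if_true, if_pos (And.intro h1 h3)]
  exact fin5_ne _ h3

theorem enabled_a1 {n : ℕ} {D : Type*} {γ : Cfg n D} {p : Fin n} (h : γ.req p = .Wait) :
    Enabled γ (.a1 p) := ⟨_, h, rfl⟩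

theorem enabled_a2 {n : ℕ} {D : Type*} {γ : Cfg n D} {p : Fin n} (h : γ.req p = .In) :
    Enabled γ (.a2 p) := by
  classical
  by_cases hc : ∀ q, q ≠ p → γ.st p q = 4
  · exact ⟨_, h, Or.inl ⟨hc, rfl⟩⟩
  · refine ⟨{ γ with chan := fun a b => if a = p ∧ b ≠ p ∧ γ.st p b ≠ 4 then
        (if γ.chan a b = none then none else γ.chan a b) else γ.chan a b },
      h, Or.inr ⟨hc, rfl, rfl, rfl, rfl, rfl, ?_, ?_⟩⟩
    · intro q hq hs
      by_cases hn : γ.chan p q = none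
      · right; simp [hn]
      · left; simp [hn]
    · intro a b hab
      simp only [if_neg hab]

/-- Once the channel `p → q` has been emptied, if `P` holds of every freshly sent message,
`P` holds of all messages in transit. -/
theorem chan_inv {n : ℕ} {D : Type*} (e : Exec n D) (p q : Fin n) (P : Msg D → Prop) (N : ℕ)
    (hP : ∀ j, N ≤ j → ∀ m : Msg D, m.sSt = (e.γ j).st p q → m.sNg = (e.γ j).ng p q → P m)
    (k : ℕ) (hk : N ≤ k) (hnone : (e.γ k).chan p q = none) :
    ∀ j, k ≤ j → ∀ m, (e.γ j).chan p q = some m → P m := by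
  intro j hj
  induction j, hj using Nat.le_induction with
  | base => intro m hm; rw [hnone] at hm; cases hm
  | succ j hj ih =>
    intro m hm
    rcases step_chan (e.valid j) p q m hm with h | ⟨h, h'⟩
    · exact ih m h
    · exact hP _ (by omega) m h h'

theorem pif_termination {n : ℕ} {D : Type*}
    (e : Exec n D) (h1 : Hyp1 e) (p : Fin n) (i : ℕ) :
    ∃ j, i ≤ j ∧ (e.γ j).req p = .Done := by
  by_contra hcon
  push Not at hcon
  -- eventually `In`
  obtain ⟨i0, hi0, hIn0⟩ : ∃ i0, i ≤ i0 ∧ (e.γ i0).req p = .In := by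
    by_contra hno
    push Not at hno
    have hW : ∀ j, i ≤ j → (e.γ j).req p = .Wait := by
      intro j hj
      have a := hno j hj
      have b := hcon j hj
      cases hc : (e.γ j).req p <;> simp_all
    obtain ⟨j, hj, hact⟩ := e.wf (.a1 p) trivial ⟨i, fun j hj => enabled_a1 (hW j hj)⟩ i
    have hv := e.valid j
    rw [hact] at hv
    obtain ⟨_, hv⟩ := hv
    apply hno (j + 1) (by omega)
    rw [hv]; simp
  have hIn : ∀ j, i0 ≤ j → (e.γ j).req p = .In := by
    intro j hj
    induction j, hj using Nat.le_induction with
    | base => exact hIn0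
    | succ j hj ih =>
      refine step_req (e.valid j) p ih (hcon _ (by omega)) ?_
      intro b hb
      exact hcon j (by omega) (h1 j p b hb)
  have hmono : ∀ q j k, i0 ≤ j → j ≤ k → (e.γ j).st p q ≤ (e.γ k).st p q := by
    intro q j k hj hk
    induction k, hk using Nat.le_induction with
    | base => exact le_rfl
    | succ k hk ih => exact ih.trans (step_st (e.valid k) p q (hIn k (by omega)))
  have hA2 := e.wf (.a2 p) trivial ⟨i0, fun j hj => enabled_a2 (hIn j hj)⟩
  have hnot4 : ∀ j, i0 ≤ j → e.act j = .a2 p → ¬ ∀ q, q ≠ p → (e.γ j).st p q = 4 := by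
    intro j hj hact hall
    have hv := e.valid j
    rw [hact] at hv
    obtain ⟨_, ⟨_, hv⟩ | ⟨hv, _⟩⟩ := hv
    · apply hcon (j + 1) (by omega)
      rw [hv]; simp
    · exact hv hall
  obtain ⟨q, hqp, hq⟩ : ∃ q, q ≠ p ∧ ∀ j, i0 ≤ j → (e.γ j).st p q ≠ 4 := by
    by_contra hno
    push Not at hno
    have hno' : ∀ q, ∃ j, q ≠ p → i0 ≤ j ∧ (e.γ j).st p q = 4 := by
      intro q
      by_cases h : q = p
      · exact ⟨0, fun h' => absurd h h'⟩
      · obtain ⟨j, hj⟩ := hno q h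
        exact ⟨j, fun _ => hj⟩
    choose N hN using hno'
    obtain ⟨j, hj, hact⟩ := hA2 (max i0 (Finset.univ.sup N))
    refine hnot4 j (le_trans (le_max_left _ _) hj) hact fun q hq => ?_
    have hNj : N q ≤ j :=
      (Finset.le_sup (Finset.mem_univ q)).trans ((le_max_right _ _).trans hj)
    have h := hmono q (N q) j (hN q hq).1 hNj
    rw [(hN q hq).2] at h
    exact le_antisymm (Fin.le_last _) h
  obtain ⟨i1, hi1, hst⟩ : ∃ i1, i0 ≤ i1 ∧ ∀ j, i1 ≤ j → (e.γ j).st p q = (e.γ i1).st p q := by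
    obtain ⟨k, hk⟩ := WellFoundedGT.monotone_chain_condition
      (⟨fun k => (e.γ (i0 + k)).st p q, fun a b hab =>
        hmono q _ _ (by omega) (by omega)⟩ : ℕ →o Fin 5)
    refine ⟨i0 + k, by omega, fun j hj => ?_⟩
    have := hk (j - i0) (by omega)
    have h2 : (e.γ (i0 + k)).st p q = (e.γ (i0 + (j - i0))).st p q := this
    rw [h2, show i0 + (j - i0) = j by omega]
  generalize hs : (e.γ i1).st p q = s at hst
  have hs4 : s ≠ 4 := hs ▸ hq i1 hi1
  have hs4' : (s : ℕ) < 4 := by clear hst hs; revert s; decide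
  -- q receives from p infinitely often
  have hrecvq := e.chanFair p q hqp.symm (by
    intro k
    obtain ⟨j, hj, hact⟩ := hA2 (max k i0)
    have hj0 : i0 ≤ j := (le_max_right _ _).trans hj
    exact ⟨j, (le_max_left _ _).trans hj, Or.inl ⟨hact, hIn j hj0, hqp, hq j hj0,
      hnot4 j hj0 hact⟩⟩)
  obtain ⟨k1, hk1, m1, hm1⟩ := hrecvq i1
  have hv1 := e.valid k1
  rw [hm1] at hv1
  have hcpq := chan_inv e p q (fun m => m.sSt = s) i1
    (fun j hj m h _ => by rw [h, hst j hj]) (k1 + 1) (by omega) (step_recv hv1).2.1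
  obtain ⟨k2, hk2, m2, hm2⟩ := hrecvq (k1 + 1)
  have hv2 := e.valid k2
  rw [hm2] at hv2
  have hng : ∀ j, k2 + 1 ≤ j → (e.γ j).ng q p = s := by
    intro j hj
    induction j, hj using Nat.le_induction with
    | base => rw [(step_recv hv2).2.2.1]; exact hcpq k2 hk2 m2 (step_recv hv2).1
    | succ j hj ih =>
      rcases step_ng (e.valid j) q p with h | ⟨m, hm, h⟩
      · rw [h, ih]
      · rw [h]; exact hcpq j (by omega) m hm
  -- p receives from q infinitely often
  have hrecvp := e.chanFair q p hqp (by
    intro k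
    obtain ⟨j, hj, m, hm⟩ := hrecvq (max k (k1 + 1))
    have hv := e.valid j
    rw [hm] at hv
    refine ⟨j, (le_max_left _ _).trans hj, Or.inr ⟨m, hm, ?_⟩⟩
    have : m.sSt = s := hcpq j ((le_max_right _ _).trans hj) m (step_recv hv).1
    rw [this]; exact hs4')
  obtain ⟨k3, hk3, m3, hm3⟩ := hrecvp (k2 + 1)
  have hv3 := e.valid k3
  rw [hm3] at hv3
  have hcqp := chan_inv e q p (fun m => m.sNg = s) (k2 + 1)
    (fun j hj m _ h => by rw [h, hng j hj]) (k3 + 1) (by omega) (step_recv hv3).2.1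
  obtain ⟨k4, hk4, m4, hm4⟩ := hrecvp (k3 + 1)
  have hv4 := e.valid k4
  rw [hm4] at hv4
  have hr := step_recv hv4
  have hm4s : m4.sNg = s := hcqp k4 hk4 m4 hr.1
  have e1 := hst k4 (by omega)
  have e2 := hst (k4 + 1) (by omega)
  exact hr.2.2.2 (by rw [e1, hm4s]) (by rw [e1]; exact hs4) (by rw [e1, e2])

end PIF
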